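/- Let S = [[1,1],[1,0]] be the star matrix. For all natural numbers k and l, the following identity of vectors in ℂ^{2^{k+l}} holds: (S^{⊗k} ⊗ S^{⊗l}) (|0⟩^{⊗k} ⊗ |1⟩^{⊗l} + |1⟩^{⊗k} ⊗ |0⟩^{⊗l}) = √2^k · |+⟩^{⊗k} ⊗ |0⟩^{⊗l} + √2^l · |0⟩^{⊗k} ⊗ |+⟩^{⊗l}. (This is the content of the NOT-obstruction lemma: the state of two Z-spider stacks joined by an X(π) spider (a NOT), carrying k and l star-edge outputs respectively, equals a sum of exactly two stabilizer product states.) -/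

import Mathlib

open Matrix Complex
open scoped Kronecker

/-- The computational basis state `|0⟩` in `ℂ²`. -/
noncomputable def ket0 : Fin 2 → ℂ := ![1, 0]

/-- The computational basis state `|1⟩` in `ℂ²`. -/
noncomputable def ket1 : Fin 2 → ℂ := ![0, 1]

/-- The state `|+⟩ = (|0⟩ + |1⟩)/√2`. -/
noncomputable def ketP : Fin 2 → ℂ := fun i => (ket0 i + ket1 i) / Real.sqrt 2

/-- The star matrix `S = [[1,1],[1,0]]`. -/
noncomputable def starMat : Matrix (Fin 2) (Fin 2) ℂ := !![1, 1; 1, 0]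

/-- The `n`-fold Kronecker (tensor) power `v^{⊗n}` of a vector `v : ℂ²`,
indexed by bit strings of length `n`. -/
noncomputable def vpow (v : Fin 2 → ℂ) (n : ℕ) : (Fin n → Fin 2) → ℂ :=
  fun x => ∏ k, v (x k)

/-- The `n`-fold Kronecker (tensor) power `M^{⊗n}` of a `2×2` matrix,
indexed by bit strings of length `n`. -/
noncomputable def kpow (M : Matrix (Fin 2) (Fin 2) ℂ) (n : ℕ) :
    Matrix (Fin n → Fin 2) (Fin n → Fin 2) ℂ :=
  Matrix.of fun i j => ∏ k, M (i k) (j k)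

/-- Kronecker (tensor) product of two vectors. -/
noncomputable def tens {I J : Type*} (v : I → ℂ) (w : J → ℂ) : I × J → ℂ :=
  fun p => v p.1 * w p.2

theorem kronecker_mulVec_tens {I J : Type*} [Fintype I] [Fintype J]
    (A : Matrix I I ℂ) (B : Matrix J J ℂ) (v : I → ℂ) (w : J → ℂ) :
    (A ⊗ₖ B).mulVec (tens v w) = tens (A.mulVec v) (B.mulVec w) := by
  ext ⟨i, j⟩
  simp only [mulVec, dotProduct, tens, kroneckerMap_apply, Fintype.sum_prod_type,
    Finset.sum_mul_sum]
  exact Finset.sum_congr rfl fun _ _ => Finset.sum_congr rfl fun _ _ => by ring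

theorem kpow_mulVec_vpow (M : Matrix (Fin 2) (Fin 2) ℂ) (v : Fin 2 → ℂ) (n : ℕ) :
    (kpow M n).mulVec (vpow v n) = vpow (M.mulVec v) n := by
  ext x
  simp only [mulVec, dotProduct, kpow, vpow, of_apply, ← Finset.prod_mul_distrib,
    Finset.prod_univ_sum, Fintype.piFinset_univ]

theorem vpow_smul (c : ℂ) (v : Fin 2 → ℂ) (n : ℕ) : vpow (c • v) n = c ^ n • vpow v n := by
  ext x
  simp [vpow, Finset.prod_mul_distrib]

theorem smul_tens {I J : Type*} (c : ℂ) (v : I → ℂ) (w : J → ℂ) :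
    tens (c • v) w = c • tens v w := by
  ext p
  simp [tens, mul_assoc]

theorem tens_smul {I J : Type*} (c : ℂ) (v : I → ℂ) (w : J → ℂ) :
    tens v (c • w) = c • tens v w := by
  ext p
  simp [tens, mul_left_comm]

theorem starMat_mulVec_ket0 : starMat.mulVec ket0 = (Real.sqrt 2 : ℂ) • ketP := by
  have h : (Real.sqrt 2 : ℂ) ≠ 0 := by simp
  ext i
  fin_cases i <;> simp [starMat, ket0, ket1, ketP, h]

theorem starMat_mulVec_ket1 : starMat.mulVec ket1 = ket0 := by
  ext i
  fin_cases i <;> simp [starMat, ket0, ket1]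

/-- NOT-obstruction lemma: the state of two Z-spider stacks joined by an X(π) spider
(a NOT), carrying `k` and `l` star-edge outputs respectively, equals a sum of exactly
two stabilizer product states:
`(S^{⊗k} ⊗ S^{⊗l})(|0⟩^{⊗k} ⊗ |1⟩^{⊗l} + |1⟩^{⊗k} ⊗ |0⟩^{⊗l})
  = √2^k · |+⟩^{⊗k} ⊗ |0⟩^{⊗l} + √2^l · |0⟩^{⊗k} ⊗ |+⟩^{⊗l}`. -/
theorem not_obstruction_decomposition (k l : ℕ) :
    (kpow starMat k ⊗ₖ kpow starMat l).mulVec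
        (tens (vpow ket0 k) (vpow ket1 l) + tens (vpow ket1 k) (vpow ket0 l))
    = ((Real.sqrt 2 : ℂ) ^ k) • tens (vpow ketP k) (vpow ket0 l)
      + ((Real.sqrt 2 : ℂ) ^ l) • tens (vpow ket0 k) (vpow ketP l) := by
  simp only [mulVec_add, kronecker_mulVec_tens, kpow_mulVec_vpow, starMat_mulVec_ket0,
    starMat_mulVec_ket1, vpow_smul, smul_tens, tens_smul]
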